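/- Let d ≥ 2 be an integer, f : ℝ^d → ℝ be C², m ≥ 2 a real number, and let v : ℝ^d → ℝ be a positive C³ function solving the v-equation 𝓛v = (1/v)·((m/2)|∇v|² + c_m) on ℝ^d. Then for every q ∈ ℝ and every continuously differentiable ψ : ℝ^d → ℝ with compact support, the integration-by-parts identity holds: (m/2 + 1 − q)·∫_{ℝ^d} e^{−f} v^{−q} |∇v|² ψ dx + c_m·∫_{ℝ^d} e^{−f} v^{−q} ψ dx = −∫_{ℝ^d} e^{−f} v^{1−q} (∇v·∇ψ) dx. [Euclidean-base instance of Lemma 5.1.] -/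

import Mathlib

open Real MeasureTheory Filter
open scoped RealInnerProductSpace

/-- Euclidean Laplacian: trace of the second derivative. -/
noncomputable def lapl {d : ℕ} (u : EuclideanSpace ℝ (Fin d) → ℝ)
    (x : EuclideanSpace ℝ (Fin d)) : ℝ :=
  ∑ i : Fin d, iteratedFDeriv ℝ 2 u x ![EuclideanSpace.single i 1, EuclideanSpace.single i 1]

/-- The constant c_m: 2/(m−2) for m > 2 and 1/2 for m = 2. -/
noncomputable def cm (m : ℝ) : ℝ := if m = 2 then 1/2 else 2/(m-2)

theorem partial_G {d : ℕ} (f v : EuclideanSpace ℝ (Fin d) → ℝ)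
    (hf : ContDiff ℝ 2 f) (hv : ContDiff ℝ 3 v) (hvpos : ∀ x, 0 < v x) (q : ℝ)
    (e x : EuclideanSpace ℝ (Fin d)) :
    fderiv ℝ (fun x => Real.exp (-f x) * v x ^ (1 - q) * fderiv ℝ v x e) x e
      = Real.exp (-f x) * v x ^ (-q) *
        (v x * (iteratedFDeriv ℝ 2 v x ![e, e] - fderiv ℝ f x e * fderiv ℝ v x e)
          + (1 - q) * fderiv ℝ v x e ^ 2) := by
  have h1 : HasFDerivAt f (fderiv ℝ f x) x :=
    (hf.differentiable (by norm_num) x).hasFDerivAt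
  have h2 : HasFDerivAt v (fderiv ℝ v x) x :=
    (hv.differentiable (by norm_num) x).hasFDerivAt
  have h3 : HasFDerivAt (fderiv ℝ v) (fderiv ℝ (fderiv ℝ v) x) x :=
    ((hv.fderiv_right (m := 1) (by norm_num)).differentiable (by norm_num) x).hasFDerivAt
  have h4 := ((h1.neg.exp).mul (h2.rpow_const (p := 1 - q) (Or.inl (hvpos x).ne'))).mul
    (h3.clm_apply (hasFDerivAt_const e x))
  have h5 : v x ^ (1 - q) = v x ^ (-q) * v x := by
    rw [show 1 - q = -q + 1 by ring, Real.rpow_add_one (hvpos x).ne']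
  have h6 : fderiv ℝ (fun x => Real.exp (-f x) * v x ^ (1 - q) * fderiv ℝ v x e) x = _ :=
    HasFDerivAt.fderiv h4
  rw [h6, iteratedFDeriv_two_apply]
  simp [h5]
  ring

theorem inner_grad {d : ℕ} (u w : EuclideanSpace ℝ (Fin d) → ℝ) (x : EuclideanSpace ℝ (Fin d)) :
    ⟪gradient u x, gradient w x⟫ = ∑ i : Fin d,
      fderiv ℝ u x (EuclideanSpace.single i 1) * fderiv ℝ w x (EuclideanSpace.single i 1) := by
  have h : ∀ (g : EuclideanSpace ℝ (Fin d) → ℝ) (i : Fin d),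
      fderiv ℝ g x (EuclideanSpace.single i 1) = gradient g x i := by
    intro g i
    have : ⟪gradient g x, EuclideanSpace.single i (1:ℝ)⟫
        = fderiv ℝ g x (EuclideanSpace.single i 1) := by
      simp only [gradient, InnerProductSpace.toDual_symm_apply]
    rw [← this, EuclideanSpace.inner_single_right]
    simp
  simp only [h, PiLp.inner_apply]
  exact Finset.sum_congr rfl fun i _ => by simp [mul_comm]

/-- Euclidean-base instance of Lemma 5.1: integration-by-parts formula for positive
solutions of the v-equation 𝓛v = (1/v)((m/2)|∇v|² + c_m). -/
theorem integration_by_parts_formula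
    (d : ℕ) (hd : 2 ≤ d) (m : ℝ) (hm : 2 ≤ m)
    (f v : EuclideanSpace ℝ (Fin d) → ℝ)
    (hf : ContDiff ℝ 2 f) (hv : ContDiff ℝ 3 v) (hvpos : ∀ x, 0 < v x)
    (hveq : ∀ x, lapl v x - ⟪gradient f x, gradient v x⟫
        = (1 / v x) * ((m / 2) * ‖gradient v x‖ ^ 2 + cm m)) :
    ∀ (q : ℝ) (ψ : EuclideanSpace ℝ (Fin d) → ℝ),
      ContDiff ℝ 1 ψ → HasCompactSupport ψ →
      (m / 2 + 1 - q) * (∫ x, Real.exp (-f x) * v x ^ (-q) * ‖gradient v x‖ ^ 2 * ψ x)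
          + cm m * (∫ x, Real.exp (-f x) * v x ^ (-q) * ψ x)
        = -∫ x, Real.exp (-f x) * v x ^ (1 - q) * ⟪gradient v x, gradient ψ x⟫ := by
  intro q ψ hψ hc
  have hrp : ∀ p : ℝ, ContDiff ℝ 1 (fun x => v x ^ p) := fun p =>
    (hv.of_le (by norm_num)).rpow_const_of_ne fun x => (hvpos x).ne'
  have hex : ContDiff ℝ 1 (fun x => Real.exp (-f x)) := (hf.of_le (by norm_num)).neg.exp
  have hdv : ∀ e, ContDiff ℝ 1 (fun x => fderiv ℝ v x e) := fun e =>
    (hv.fderiv_right (m := 1) (by norm_num)).clm_apply contDiff_const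
  have hG : ∀ e, ContDiff ℝ 1 (fun x => Real.exp (-f x) * v x ^ (1 - q) * fderiv ℝ v x e) :=
    fun e => (hex.mul (hrp _)).mul (hdv e)
  have hdψ : ∀ e, Continuous (fun x => fderiv ℝ ψ x e) := fun e =>
    (hψ.continuous_fderiv (by norm_num)).clm_apply continuous_const
  have hcψ : ∀ e, HasCompactSupport (fun x => fderiv ℝ ψ x e) := fun e => hc.fderiv_apply ℝ e
  have hnorm : ∀ x, ‖gradient v x‖ ^ 2
      = ∑ i : Fin d, fderiv ℝ v x (EuclideanSpace.single i 1) ^ 2 := by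
    intro x
    rw [← real_inner_self_eq_norm_sq, inner_grad]
    simp only [sq]
  have hncont : Continuous (fun x => ‖gradient v x‖ ^ 2) := by
    simp only [hnorm]
    exact continuous_finsetSum _ fun i _ => (hdv _).continuous.pow 2
  have hI1 : ∀ e, Integrable (fun x => Real.exp (-f x) * v x ^ (1 - q) * fderiv ℝ v x e
      * fderiv ℝ ψ x e) := fun e =>
    ((hG e).continuous.mul (hdψ e)).integrable_of_hasCompactSupport (hcψ e).mul_left
  have hI2 : ∀ e, Integrable (fun x =>
      fderiv ℝ (fun x => Real.exp (-f x) * v x ^ (1 - q) * fderiv ℝ v x e) x e * ψ x) := fun e =>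
    ((((hG e).continuous_fderiv (by norm_num)).clm_apply continuous_const).mul
      hψ.continuous).integrable_of_hasCompactSupport hc.mul_left
  have hibp : ∀ e, ∫ x, Real.exp (-f x) * v x ^ (1 - q) * fderiv ℝ v x e * fderiv ℝ ψ x e
      = -∫ x, fderiv ℝ (fun x => Real.exp (-f x) * v x ^ (1 - q) * fderiv ℝ v x e) x e * ψ x :=
    fun e => integral_mul_fderiv_eq_neg_fderiv_mul_of_integrable (hI2 e) (hI1 e)
      (((hG e).continuous.mul hψ.continuous).integrable_of_hasCompactSupport hc.mul_left)
      (fun x _ => (hG e).differentiable (by norm_num) x)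
      (fun x _ => hψ.differentiable (by norm_num) x)
  have hA : Integrable (fun x => Real.exp (-f x) * v x ^ (-q) * ‖gradient v x‖ ^ 2 * ψ x) :=
    (((hex.continuous.mul (hrp _).continuous).mul hncont).mul
      hψ.continuous).integrable_of_hasCompactSupport hc.mul_left
  have hB : Integrable (fun x => Real.exp (-f x) * v x ^ (-q) * ψ x) :=
    ((hex.continuous.mul (hrp _).continuous).mul
      hψ.continuous).integrable_of_hasCompactSupport hc.mul_left
  have hR : ∫ x, Real.exp (-f x) * v x ^ (1 - q) * ⟪gradient v x, gradient ψ x⟫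
      = -∑ i : Fin d, ∫ x, fderiv ℝ (fun x => Real.exp (-f x) * v x ^ (1 - q)
          * fderiv ℝ v x (EuclideanSpace.single i 1)) x (EuclideanSpace.single i 1) * ψ x := by
    rw [← Finset.sum_neg_distrib]
    simp only [← hibp]
    rw [← integral_finsetSum _ fun i _ => hI1 _]
    congr 1
    funext x
    rw [inner_grad, Finset.mul_sum]
    exact Finset.sum_congr rfl fun i _ => by ring
  rw [hR, neg_neg, ← integral_finsetSum _ fun i _ => hI2 _, ← integral_const_mul,
    ← integral_const_mul, ← integral_add (hA.const_mul _) (hB.const_mul _)]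
  congr 1
  funext x
  have hx := hveq x
  rw [← Finset.sum_mul]
  simp only [partial_G f v hf hv hvpos q]
  rw [← Finset.mul_sum, Finset.sum_add_distrib, ← Finset.mul_sum, ← Finset.mul_sum, ← hnorm,
    Finset.sum_sub_distrib, ← inner_grad]
  change _ = _ * (v x * (lapl v x - _) + _) * _
  rw [hx]
  have := (hvpos x).ne'
  field_simp
  ring
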